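/- (Direct comparison principle for the logarithmic fast diffusion equation.) Let T > 0, let D ⊆ ℂ be the open unit disk, and let 𝓜 ⊆ D × (0,T) be an open set whose closure is compact and contained in D × (0,T). Let u, v : closure(𝓜) → (0,∞) be continuous positive functions which on 𝓜 possess continuous spatial gradient, spatial Laplacian and time derivative, all of which are bounded on 𝓜, and which satisfy the logarithmic fast diffusion equation ∂_t u = Δ log u and ∂_t v = Δ log v on 𝓜. If v > u at every point of the parabolic boundary ∂_P 𝓜, then v ≥ u on 𝓜. -/

import Mathlib

open Set MeasureTheory Filter Metric

/-- The Euclidean Laplacian of `f : ℂ → ℝ` at `z`, i.e. `∂²f/∂x² + ∂²f/∂y²`. -/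
noncomputable def lap (f : ℂ → ℝ) (z : ℂ) : ℝ :=
  iteratedFDeriv ℝ 2 f z ![1, 1] + iteratedFDeriv ℝ 2 f z ![Complex.I, Complex.I]

/-- The time-timeSlice of a spacetime `M ⊆ ℂ × ℝ` at time `t`. -/
def timeSlice (M : Set (ℂ × ℝ)) (t : ℝ) : Set ℂ := {z | (z, t) ∈ M}

/-- The conformal distance on `Ω` induced by a conformal factor `v`: the infimum of
`v`-lengths of `C¹` paths in `Ω` joining `x` to `y`. -/
noncomputable def confDist (v : ℂ → ℝ) (Ω : Set ℂ) (x y : ℂ) : ℝ :=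
  sInf {L : ℝ | ∃ γ : ℝ → ℂ, ContDiffOn ℝ 1 γ (Icc 0 1) ∧
    (∀ s ∈ Icc (0:ℝ) 1, γ s ∈ Ω) ∧ γ 0 = x ∧ γ 1 = y ∧
    L = ∫ s in (0:ℝ)..1, Real.sqrt (v (γ s)) * ‖derivWithin γ (Icc 0 1) s‖}

/-- The conformal ball of centre `p` and radius `ρ` in `Ω` for the metric `v|dz|²`. -/
def confBall (v : ℂ → ℝ) (Ω : Set ℂ) (p : ℂ) (ρ : ℝ) : Set ℂ :=
  {z ∈ connectedComponentIn Ω p | confDist v Ω p z < ρ}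

/-- The conformal metric `v|dz|²` is complete on `Ω`: every connected component of `Ω` is a
complete metric space with respect to the induced distance `confDist v Ω`. -/
def ConfComplete (v : ℂ → ℝ) (Ω : Set ℂ) : Prop :=
  ∀ x₀ ∈ Ω, ∀ x : ℕ → ℂ, (∀ n, x n ∈ connectedComponentIn Ω x₀) →
    (∀ ε : ℝ, 0 < ε → ∃ N : ℕ, ∀ m ≥ N, ∀ n ≥ N, confDist v Ω (x m) (x n) < ε) →
    ∃ l ∈ connectedComponentIn Ω x₀,
      Tendsto (fun n => confDist v Ω (x n) l) atTop (nhds 0)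

/-- A conformal Ricci flow spacetime in the ambient space `ℂ × (0,T)`:
`M` is a connected open subset of `ℂ × (0,T)` with non-empty time-slices, and `u` is a smooth
positive conformal factor on `M` solving the logarithmic fast diffusion equation
`∂u/∂t = Δ log u`. -/
structure ConfRFS (T : ℝ) (M : Set (ℂ × ℝ)) (u : ℂ → ℝ → ℝ) : Prop where
  sub : M ⊆ {p : ℂ × ℝ | p.2 ∈ Ioo 0 T}
  opn : IsOpen M
  conn : IsConnected M
  nonempty : ∀ t ∈ Ioo (0:ℝ) T, (timeSlice M t).Nonempty
  pos : ∀ p ∈ M, 0 < u p.1 p.2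
  smooth : ContDiffOn ℝ (⊤ : ℕ∞) (fun p : ℂ × ℝ => u p.1 p.2) M
  lfde : ∀ p ∈ M, deriv (u p.1) p.2 = lap (fun z => Real.log (u z p.2)) p.1

/-- A conformal Ricci flow spacetime is complete if the metric `u(·,t)|dz|²` is complete on the
timeSlice `M_t` for every `t ∈ (0,T)`. -/
def ConfRFSComplete (T : ℝ) (M : Set (ℂ × ℝ)) (u : ℂ → ℝ → ℝ) : Prop :=
  ∀ t ∈ Ioo (0:ℝ) T, ConfComplete (fun z => u z t) (timeSlice M t)

/-- There is a time-preserving path in `M` from time `s` to the point `(z,t)`. -/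
def TimePreservingFrom (M : Set (ℂ × ℝ)) (s : ℝ) (z : ℂ) (t : ℝ) : Prop :=
  ∃ γ : ℝ → ℂ, ContinuousOn γ (Icc s t) ∧ (∀ r ∈ Icc s t, (γ r, r) ∈ M) ∧ γ t = z

/-- The hindsight function of a spacetime `M`. -/
noncomputable def hindsight (M : Set (ℂ × ℝ)) (z : ℂ) (t : ℝ) : ℝ :=
  sInf {s : ℝ | 0 < s ∧ s ≤ t ∧ TimePreservingFrom M s z t}

/-- A spacetime is initially determined if its hindsight function vanishes identically. -/
def InitiallyDetermined (M : Set (ℂ × ℝ)) : Prop :=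
  ∀ p ∈ M, hindsight M p.1 p.2 = 0

/-- A spacetime in `ℂ × (0,T)` is expanding if worldlines persist until the final time. -/
def Expanding (T : ℝ) (M : Set (ℂ × ℝ)) : Prop :=
  ∀ (z : ℂ) (t t' : ℝ), (z, t) ∈ M → t ≤ t' → t' < T → (z, t') ∈ M

/-- An expanding spacetime is continuous if each timeSlice is the interior of the intersection of
all later slices. -/
def ContinuousSpacetime (T : ℝ) (M : Set (ℂ × ℝ)) : Prop :=
  ∀ s ∈ Ioo (0:ℝ) T, timeSlice M s = interior (⋂ t ∈ Ioo s T, timeSlice M t)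

/-- The vanishing time of the point `(z,t)`: the supremum of the connected component containing
`t` of the set of times at which `z` belongs to the spacetime. -/
noncomputable def vanishTime (M : Set (ℂ × ℝ)) (z : ℂ) (t : ℝ) : ℝ :=
  sSup (connectedComponentIn {r : ℝ | (z, r) ∈ M} t)

/-- The parabolic boundary of an open set `M ⊆ ℂ × ℝ`: the topological boundary minus those
boundary points `(z,t)` admitting `ε > 0` with `B(z,ε) × (t−ε,t) ⊆ M`. -/
def parabolicBoundary (M : Set (ℂ × ℝ)) : Set (ℂ × ℝ) :=
  frontier M \
    {p ∈ frontier M | ∃ ε > 0, Metric.ball p.1 ε ×ˢ Ioo (p.2 - ε) p.2 ⊆ M}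

theorem deriv_deriv_line_eq_iteratedFDeriv {f : ℂ → ℝ} {x : ℂ} (hf : ContDiffAt ℝ 2 f x) (e : ℂ) :
    deriv (deriv fun τ : ℝ => f (x + τ • e)) 0 = iteratedFDeriv ℝ 2 f x ![e, e] := by
  have hline : ∀ τ : ℝ, HasDerivAt (fun τ : ℝ => x + τ • e) e τ := fun τ => by
    simpa using ((hasDerivAt_id τ).smul_const e).const_add x
  have hx : Tendsto (fun τ : ℝ => x + τ • e) (nhds 0) (nhds x) := by
    simpa [ContinuousAt] using (hline 0).continuousAt
  have h1 : ∀ᶠ y in nhds x, DifferentiableAt ℝ f y :=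
    (hf.eventually (by simp)).mono fun y hy => hy.differentiableAt (by simp)
  have h2 : (deriv fun τ : ℝ => f (x + τ • e)) =ᶠ[nhds 0]
      fun τ => fderiv ℝ f (x + τ • e) e := by
    filter_upwards [hx.eventually h1] with τ hτ
    exact (hτ.hasFDerivAt.comp_hasDerivAt τ (hline τ)).deriv
  rw [h2.deriv_eq, iteratedFDeriv_two_apply]
  have h3 : DifferentiableAt ℝ (fderiv ℝ f) x :=
    (hf.fderiv_right (m := 1) (by norm_num)).differentiableAt (by simp)
  have h4 : HasFDerivAt (fderiv ℝ f) (fderiv ℝ (fderiv ℝ f) x) (x + (0 : ℝ) • e) := by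
    rw [zero_smul, add_zero]
    exact h3.hasFDerivAt
  have h5 : HasDerivAt (fun τ : ℝ => fderiv ℝ f (x + τ • e)) (fderiv ℝ (fderiv ℝ f) x e) 0 :=
    HasFDerivAt.comp_hasDerivAt (f := fun τ : ℝ => x + τ • e) 0 h4 (hline 0)
  have h6 : HasDerivAt (fun τ : ℝ => fderiv ℝ f (x + τ • e) e)
      (fderiv ℝ (fderiv ℝ f) x e e) 0 :=
    ((ContinuousLinearMap.apply ℝ ℝ e).hasFDerivAt).comp_hasDerivAt (0 : ℝ) h5
  exact h6.deriv

theorem iteratedFDeriv_two_nonpos_of_isLocalMax {f : ℂ → ℝ} {x : ℂ} (hf : ContDiffAt ℝ 2 f x)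
    (hmax : IsLocalMax f x) (e : ℂ) : iteratedFDeriv ℝ 2 f x ![e, e] ≤ 0 := by
  rw [← deriv_deriv_line_eq_iteratedFDeriv hf e]
  by_contra! hpos
  have hline : ContinuousAt (fun τ : ℝ => x + τ • e) 0 := by fun_prop
  have hx : Tendsto (fun τ : ℝ => x + τ • e) (nhds 0) (nhds x) := by
    simpa [ContinuousAt] using hline
  have hmax' : IsLocalMax (fun τ : ℝ => f (x + τ • e)) 0 := by
    filter_upwards [hx.eventually hmax] with τ hτ
    simpa using (show f (x + τ • e) ≤ f x from hτ)
  have hmin := isLocalMin_of_deriv_deriv_pos hpos hmax'.deriv_eq_zero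
    (ContinuousAt.comp (f := fun τ : ℝ => x + τ • e) (g := f)
      (by simpa using hf.continuousAt) hline)
  have hconst : (fun τ : ℝ => f (x + τ • e)) =ᶠ[nhds 0] fun _ => f (x + (0 : ℝ) • e) := by
    filter_upwards [hmax', hmin] with τ h1 h2 using le_antisymm h1 h2
  rw [hconst.deriv.deriv_eq] at hpos
  simp at hpos

theorem lap_nonpos_of_isLocalMax {f : ℂ → ℝ} {x : ℂ} (hf : ContDiffAt ℝ 2 f x)
    (hmax : IsLocalMax f x) : lap f x ≤ 0 :=
  add_nonpos (iteratedFDeriv_two_nonpos_of_isLocalMax hf hmax _)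
    (iteratedFDeriv_two_nonpos_of_isLocalMax hf hmax _)

theorem lap_sub {f g : ℂ → ℝ} {x : ℂ} (hf : ContDiffAt ℝ 2 f x) (hg : ContDiffAt ℝ 2 g x) :
    lap (fun y => f y - g y) x = lap f x - lap g x := by
  have h : iteratedFDeriv ℝ 2 (fun y => f y - g y) x
      = iteratedFDeriv ℝ 2 f x - iteratedFDeriv ℝ 2 g x := iteratedFDeriv_sub_apply hf hg
  simp only [lap, h, sub_apply]
  ring

theorem contDiff_const_mul_norm_sub_sq (c : ℝ) (z : ℂ) :
    ContDiff ℝ 2 fun y : ℂ => c * ‖y - z‖ ^ 2 :=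
  contDiff_const.mul ((contDiff_id.sub contDiff_const).norm_sq ℝ)

theorem lap_const_mul_norm_sub_sq (c : ℝ) (z x : ℂ) :
    lap (fun y => c * ‖y - z‖ ^ 2) x = 4 * c := by
  have key : ∀ e : ℂ, ‖e‖ = 1 →
      iteratedFDeriv ℝ 2 (fun y => c * ‖y - z‖ ^ 2) x ![e, e] = 2 * c := by
    intro e he
    rw [← deriv_deriv_line_eq_iteratedFDeriv (contDiff_const_mul_norm_sub_sq c z).contDiffAt e]
    have h : (fun τ : ℝ => c * ‖x + τ • e - z‖ ^ 2) =
        fun τ => c * (‖x - z‖ ^ 2 + 2 * τ * inner ℝ (x - z) e + τ ^ 2) := by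
      funext τ
      rw [add_sub_right_comm, norm_add_sq_real, inner_smul_right, norm_smul, he, mul_one,
        Real.norm_eq_abs, sq_abs]
      ring
    have h1 : deriv (fun τ : ℝ => c * ‖x + τ • e - z‖ ^ 2) =
        fun τ => c * (2 * inner ℝ (x - z) e + 2 * τ) := by
      rw [h]
      funext τ
      have := ((((((hasDerivAt_id τ).const_mul 2).mul_const (inner ℝ (x - z) e)).const_add
        (‖x - z‖ ^ 2)).add ((hasDerivAt_id τ).pow 2)).const_mul c).deriv
      simpa using this
    rw [h1]
    have := ((((hasDerivAt_id (0 : ℝ)).const_mul 2).const_add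
      (2 * inner ℝ (x - z) e)).const_mul c).deriv
    simp only [id] at this
    rw [this]
    ring
  rw [lap, key 1 (by simp), key Complex.I (by simp)]
  ring

theorem deriv_nonneg_of_le_left {f : ℝ → ℝ} {d b s : ℝ} (hf : HasDerivAt f d s) (hb : b < s)
    (hmax : ∀ τ ∈ Ioo b s, f τ ≤ f s) : 0 ≤ d := by
  have h := (hasDerivWithinAt_iff_tendsto_slope' (s := Iio s) (by simp)).1 hf.hasDerivWithinAt
  refine ge_of_tendsto h ?_
  filter_upwards [Ioo_mem_nhdsLT hb] with τ hτ
  rw [slope_def_field]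
  exact div_nonneg_of_nonpos (by linarith [hmax τ hτ]) (by linarith [hτ.2])

theorem exists_backward_cylinder {M : Set (ℂ × ℝ)} (hM : IsOpen M) {p : ℂ × ℝ}
    (hp : p ∈ closure M) (hp' : p ∉ parabolicBoundary M) :
    ∃ ε > 0, Metric.ball p.1 ε ×ˢ Ioo (p.2 - ε) p.2 ⊆ M := by
  by_cases hpM : p ∈ M
  · obtain ⟨ε, hε, h⟩ := Metric.isOpen_iff.1 hM p hpM
    refine ⟨ε, hε, fun q hq => h ?_⟩
    rw [← ball_prod_same, Real.ball_eq_Ioo]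
    exact ⟨hq.1, hq.2.1, hq.2.2.trans (by linarith)⟩
  · have hfr : p ∈ frontier M := ⟨hp, by rwa [hM.interior_eq]⟩
    by_contra hcon
    exact hp' ⟨hfr, fun h => hcon h.2⟩

theorem reaction_le {u v m B A L e w a : ℝ} (hm : 0 < m) (hmu : m ≤ u) (hmv : m ≤ v)
    (hw : w = Real.log u - Real.log v) (hw0 : 0 ≤ w) (hL : |L| ≤ B) (he : 0 < e) (ha : 0 ≤ a)
    (hAL : e * (A - L) ≤ 4 * a) :
    e * (A / u - L / v) ≤ 4 * a / m + B / m * (e * w) := by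
  have hu : 0 < u := hm.trans_le hmu
  have hv : 0 < v := hm.trans_le hmv
  have hB : 0 ≤ B := (abs_nonneg L).trans hL
  have h1 : e * (A - L) / u ≤ 4 * a / m :=
    (div_le_div_of_nonneg_right hAL hu.le).trans
      (div_le_div_of_nonneg_left (by linarith) hm hmu)
  have hlog : 1 - v / u ≤ w := by
    have := Real.log_le_sub_one_of_pos (div_pos hv hu)
    rw [Real.log_div hv.ne' hu.ne'] at this
    linarith
  have hvu : v ≤ u := by
    rw [← Real.log_le_log_iff hv hu]
    linarith
  have h2 : 1 / v - 1 / u ≤ w / m := by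
    have h3 : 1 / v - 1 / u = (1 - v / u) / v := by field_simp
    rw [h3]
    exact (div_le_div_of_nonneg_right hlog hv.le).trans (div_le_div_of_nonneg_left hw0 hm hmv)
  have h4 : 0 ≤ 1 / v - 1 / u := sub_nonneg.2 (one_div_le_one_div_of_le hv hvu)
  have h5 : L * (1 / u - 1 / v) ≤ B * (w / m) :=
    calc L * (1 / u - 1 / v) = -L * (1 / v - 1 / u) := by ring
      _ ≤ B * (1 / v - 1 / u) :=
        mul_le_mul_of_nonneg_right ((neg_le_abs L).trans hL) h4
      _ ≤ B * (w / m) := mul_le_mul_of_nonneg_left h2 hB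
  calc e * (A / u - L / v) = e * (A - L) / u + e * (L * (1 / u - 1 / v)) := by
        field_simp
        ring
    _ ≤ 4 * a / m + e * (B * (w / m)) :=
        add_le_add h1 (mul_le_mul_of_nonneg_left h5 he.le)
    _ = 4 * a / m + B / m * (e * w) := by ring

/-- Direct comparison principle for the logarithmic fast diffusion equation on a
compactly contained open subset of `D × (0,T)`. -/
theorem lfde_comparison_principle
    (T : ℝ) (hT : 0 < T) (M : Set (ℂ × ℝ)) (hMopen : IsOpen M)
    (hMcpt : IsCompact (closure M))
    (hMsub : closure M ⊆ (Metric.ball (0:ℂ) 1) ×ˢ Ioo 0 T)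
    (u v : ℂ → ℝ → ℝ)
    -- continuity and positivity on the closure
    (hu_cont : ContinuousOn (fun p : ℂ × ℝ => u p.1 p.2) (closure M))
    (hv_cont : ContinuousOn (fun p : ℂ × ℝ => v p.1 p.2) (closure M))
    (hu_pos : ∀ p ∈ closure M, 0 < u p.1 p.2)
    (hv_pos : ∀ p ∈ closure M, 0 < v p.1 p.2)
    -- existence of spatial gradient, spatial Laplacian and time derivative on `M`
    (hu_sp : ∀ p ∈ M, ContDiffAt ℝ 2 (fun z => u z p.2) p.1)
    (hv_sp : ∀ p ∈ M, ContDiffAt ℝ 2 (fun z => v z p.2) p.1)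
    (hu_t : ∀ p ∈ M, DifferentiableAt ℝ (u p.1) p.2)
    (hv_t : ∀ p ∈ M, DifferentiableAt ℝ (v p.1) p.2)
    -- continuity of these derivatives on `M`
    (hu_dc : ContinuousOn (fun p : ℂ × ℝ => fderiv ℝ (fun z => u z p.2) p.1) M ∧
             ContinuousOn (fun p : ℂ × ℝ => lap (fun z => u z p.2) p.1) M ∧
             ContinuousOn (fun p : ℂ × ℝ => deriv (u p.1) p.2) M)
    (hv_dc : ContinuousOn (fun p : ℂ × ℝ => fderiv ℝ (fun z => v z p.2) p.1) M ∧
             ContinuousOn (fun p : ℂ × ℝ => lap (fun z => v z p.2) p.1) M ∧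
             ContinuousOn (fun p : ℂ × ℝ => deriv (v p.1) p.2) M)
    -- boundedness of these derivatives on `M`
    (hbdd : ∃ B : ℝ, ∀ p ∈ M,
        ‖fderiv ℝ (fun z => u z p.2) p.1‖ ≤ B ∧ |lap (fun z => u z p.2) p.1| ≤ B ∧
        |deriv (u p.1) p.2| ≤ B ∧
        ‖fderiv ℝ (fun z => v z p.2) p.1‖ ≤ B ∧ |lap (fun z => v z p.2) p.1| ≤ B ∧
        |deriv (v p.1) p.2| ≤ B)
    -- both solve the logarithmic fast diffusion equation on `M`
    (hu_lfde : ∀ p ∈ M, deriv (u p.1) p.2 = lap (fun z => Real.log (u z p.2)) p.1)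
    (hv_lfde : ∀ p ∈ M, deriv (v p.1) p.2 = lap (fun z => Real.log (v z p.2)) p.1)
    -- strict inequality on the parabolic boundary
    (hbdry : ∀ p ∈ parabolicBoundary M, u p.1 p.2 < v p.1 p.2) :
    ∀ p ∈ M, u p.1 p.2 ≤ v p.1 p.2 := by
  by_contra! hcon
  obtain ⟨p₀, hp₀, hlt⟩ := hcon
  obtain ⟨B, hB⟩ := hbdd
  have hne : (closure M).Nonempty := ⟨p₀, subset_closure hp₀⟩
  obtain ⟨m, hm, hmu, hmv⟩ : ∃ m : ℝ, 0 < m ∧ (∀ p ∈ closure M, m ≤ u p.1 p.2) ∧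
      ∀ p ∈ closure M, m ≤ v p.1 p.2 := by
    obtain ⟨p, hp, hpm⟩ := hMcpt.exists_isMinOn hne hu_cont
    obtain ⟨q, hq, hqm⟩ := hMcpt.exists_isMinOn hne hv_cont
    exact ⟨min (u p.1 p.2) (v q.1 q.2), lt_min (hu_pos p hp) (hv_pos q hq),
      fun x hx => (min_le_left _ _).trans (hpm hx), fun x hx => (min_le_right _ _).trans (hqm hx)⟩
  obtain ⟨C, hC⟩ : ∃ C : ℝ, C = B / m + 1 := ⟨_, rfl⟩
  let g : ℂ × ℝ → ℝ := fun p =>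
    Real.exp (-C * p.2) * (Real.log (u p.1 p.2) - Real.log (v p.1 p.2))
  have hg : ContinuousOn g (closure M) := by
    refine ContinuousOn.mul (by fun_prop) (ContinuousOn.sub ?_ ?_)
    · exact hu_cont.log fun p hp => (hu_pos p hp).ne'
    · exact hv_cont.log fun p hp => (hv_pos p hp).ne'
  obtain ⟨P, hP, hPmax⟩ := hMcpt.exists_isMaxOn hne hg
  have hG : 0 < g P := by
    refine lt_of_lt_of_le (mul_pos (Real.exp_pos _) ?_) (hPmax (subset_closure hp₀))
    exact sub_pos.2 (Real.log_lt_log (hv_pos _ (subset_closure hp₀)) hlt)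
  have hPb : P ∉ parabolicBoundary M := fun hPb => by
    have h := Real.log_lt_log (hu_pos P hP) (hbdry P hPb)
    have : g P < 0 := mul_neg_of_pos_of_neg (Real.exp_pos _) (sub_neg.2 h)
    linarith
  obtain ⟨ε, hε, hcyl⟩ := exists_backward_cylinder hMopen hP hPb
  obtain ⟨r, hr, hrε, hr1⟩ : ∃ r : ℝ, 0 < r ∧ r < ε ∧ r < 1 :=
    ⟨min (ε / 2) (1 / 2), by positivity, (min_le_left _ _).trans_lt (by linarith),
      (min_le_right _ _).trans_lt (by norm_num)⟩
  have hrsq : r ^ 2 < r := by nlinarith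
  obtain ⟨a, ha, haG⟩ : ∃ a : ℝ, 0 < a ∧ a * (2 + 4 / m) < g P := by
    have hc : 0 < 2 + 4 / m := by positivity
    refine ⟨g P / 2 / (2 + 4 / m), by positivity, ?_⟩
    rw [div_mul_cancel₀ _ hc.ne']
    linarith
  have hcyl' : ∀ x ∈ closedBall P.1 r, ∀ s ∈ Ico (P.2 - r) P.2, (x, s) ∈ M := fun x hx s hs =>
    hcyl ⟨closedBall_subset_ball hrε hx, by linarith [hs.1], hs.2⟩
  let h : ℂ × ℝ → ℝ := fun q => g q - a * (‖q.1 - P.1‖ ^ 2 + (P.2 - q.2))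
  have hh : ContinuousOn h (closure M) := hg.sub (by fun_prop)
  have hhP : h P = g P := by simp [h]
  obtain ⟨σ, hσ, hσh⟩ : ∃ σ ∈ Ioo (P.2 - r) P.2, g P - a * r ^ 2 < h (P.1, σ) := by
    have hmem : ∀ᶠ σ in nhdsWithin P.2 (Iio P.2), σ ∈ Ioo (P.2 - r) P.2 :=
      Ioo_mem_nhdsLT (by linarith)
    have ht : Tendsto (fun σ : ℝ => (P.1, σ)) (nhdsWithin P.2 (Iio P.2))
        (nhdsWithin P (closure M)) := by
      refine tendsto_nhdsWithin_iff.2 ⟨?_, hmem.mono fun σ hσ => subset_closure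
        (hcyl' _ (mem_closedBall_self hr.le) σ ⟨hσ.1.le, hσ.2⟩)⟩
      have : ContinuousAt (fun σ : ℝ => (P.1, σ)) P.2 := by fun_prop
      exact this.tendsto.mono_left nhdsWithin_le_nhds
    have hlim := ((hh P hP).tendsto.comp ht).eventually_const_lt
      (show g P - a * r ^ 2 < h P by rw [hhP]; have := mul_pos ha (pow_pos hr 2); linarith)
    obtain ⟨σ, h1, h2⟩ := (hmem.and hlim).exists
    exact ⟨σ, h1, h2⟩
  have hQM : closedBall P.1 r ×ˢ Icc (P.2 - r) σ ⊆ M := fun q hq =>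
    hcyl' q.1 hq.1 q.2 ⟨hq.2.1, hq.2.2.trans_lt hσ.2⟩
  obtain ⟨⟨x, s⟩, hxs, hmax⟩ := ((isCompact_closedBall P.1 r).prod
    (isCompact_Icc (a := P.2 - r) (b := σ))).exists_isMaxOn
    ⟨(P.1, σ), mem_closedBall_self hr.le, hσ.1.le, le_rfl⟩
    (hh.mono (hQM.trans subset_closure))
  have hM' : (x, s) ∈ M := hQM hxs
  have hcl : (x, s) ∈ closure M := subset_closure hM'
  have hsσ : s ≤ σ := hxs.2.2
  have hmaxσ : h (P.1, σ) ≤ h (x, s) := hmax ⟨mem_closedBall_self hr.le, hσ.1.le, le_rfl⟩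
  have hgle : g (x, s) ≤ g P := hPmax hcl
  have hhxs : h (x, s) = g (x, s) - a * (‖x - P.1‖ ^ 2 + (P.2 - s)) := rfl
  have hsP : s < P.2 := hsσ.trans_lt hσ.2
  have hsmall : ‖x - P.1‖ ^ 2 + (P.2 - s) < r ^ 2 := by
    refine lt_of_mul_lt_mul_left ?_ ha.le
    linarith
  have hxr : ‖x - P.1‖ < r :=
    lt_of_pow_lt_pow_left₀ 2 hr.le (by linarith)
  have hsr : P.2 - r < s := by nlinarith [sq_nonneg ‖x - P.1‖]
  have hglow : g P - a ≤ g (x, s) := by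
    have h1 : 0 ≤ a * (‖x - P.1‖ ^ 2 + (P.2 - s)) :=
      mul_nonneg ha.le (add_nonneg (sq_nonneg _) (by linarith))
    have h2 : a * r ^ 2 ≤ a * 1 := mul_le_mul_of_nonneg_left (by linarith) ha.le
    linarith
  obtain ⟨w, hw⟩ : ∃ w, w = Real.log (u x s) - Real.log (v x s) := ⟨_, rfl⟩
  obtain ⟨e, he⟩ : ∃ e, e = Real.exp (-C * s) := ⟨_, rfl⟩
  have he0 : 0 < e := he ▸ Real.exp_pos _
  have hgew : g (x, s) = e * w := by rw [hw, he]
  have hew : 0 < e * w := by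
    have : 0 ≤ a * (4 / m) := by positivity
    linarith
  have hw0 : 0 < w := pos_of_mul_pos_right hew he0.le
  have hupos := hu_pos _ hcl
  have hvpos := hv_pos _ hcl
  -- the spatial second-order condition
  have hlu : ContDiffAt ℝ 2 (fun y => Real.log (u y s)) x := (hu_sp _ hM').log hupos.ne'
  have hlv : ContDiffAt ℝ 2 (fun y => Real.log (v y s)) x := (hv_sp _ hM').log hvpos.ne'
  have hsq := (contDiff_const_mul_norm_sub_sq (a / e) P.1).contDiffAt (x := x)
  have hspace : IsLocalMax (fun y => Real.log (u y s) - Real.log (v y s)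
      - a / e * ‖y - P.1‖ ^ 2) x := by
    filter_upwards [isOpen_ball.mem_nhds (show x ∈ ball P.1 r by rwa [mem_ball_iff_norm])]
      with y hy
    have h1 : h (y, s) ≤ h (x, s) := hmax ⟨ball_subset_closedBall hy, hxs.2⟩
    have h2 : ∀ y, h (y, s) = e * (Real.log (u y s) - Real.log (v y s)
        - a / e * ‖y - P.1‖ ^ 2) - a * (P.2 - s) := fun y => by
      simp only [h, g, ← he]
      field_simp
      ring
    rw [h2, h2] at h1
    exact le_of_mul_le_mul_left (by linarith) he0
  have hlap := lap_nonpos_of_isLocalMax ((hlu.sub hlv).sub hsq) hspace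
  rw [lap_sub (hlu.sub hlv) hsq, lap_sub hlu hlv, lap_const_mul_norm_sub_sq,
    ← hu_lfde _ hM', ← hv_lfde _ hM'] at hlap
  have hAL : e * (deriv (u x) s - deriv (v x) s) ≤ 4 * a := by
    have h1 := mul_le_mul_of_nonneg_left hlap he0.le
    have h2 : e * (4 * (a / e)) = 4 * a := by field_simp
    simp only [mul_sub, h2] at h1 ⊢
    linarith
  -- the one-sided first-order condition in time
  have htime : 0 ≤ e * (-C) * w + e * (deriv (u x) s / u x s - deriv (v x) s / v x s) + a := by
    have h1 : HasDerivAt (fun τ : ℝ => Real.exp (-C * τ)) (e * (-C)) s := by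
      simpa [he] using ((hasDerivAt_id s).const_mul (-C)).exp
    have h2 := ((hu_t _ hM').hasDerivAt.log hupos.ne').sub
      ((hv_t _ hM').hasDerivAt.log hvpos.ne')
    have h3 := (((hasDerivAt_id s).const_sub P.2).const_add (‖x - P.1‖ ^ 2)).const_mul a
    have h4 := (h1.mul h2).sub h3
    have h5 := deriv_nonneg_of_le_left h4 hsr fun τ hτ =>
      hmax (a := (x, τ)) ⟨hxs.1, hτ.1.le, hτ.2.le.trans hsσ⟩
    simp only [Pi.sub_apply, ← hw, ← he] at h5
    linarith
  have hreact := reaction_le hm (hmu _ hcl) (hmv _ hcl) hw hw0.le (hB _ hM').2.2.2.2.2 he0 ha.le hAL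
  have h1 : e * (-C) * w = -(B / m * (e * w)) - e * w := by rw [hC]; ring
  have h2 : a * (2 + 4 / m) = 2 * a + 4 * a / m := by ring
  linarith
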